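/- arXiv:0804.3136 — 2 statements merged into one kernel-verified Lean document; each statement's English description precedes it below -/
import Mathlib

section
/- For fixed real u > 0, the limit as v → 0⁺ of (B(u,v) - 1/v) equals u · (∂/∂v B(u,v))|_{v=1} + 1/u, where ∂/∂v B(u,v)|_{v=1} = ∫₀¹ t^(u-1) log(1-t) dt. -/
open MeasureTheory Set Filter Topology

lemma ofReal_rpow_mul_one_sub_rpow (u v : ℝ) {t : ℝ} (ht : t ∈ uIcc (0 : ℝ) 1) :
    (((t ^ (u - 1) * (1 - t) ^ (v - 1) : ℝ)) : ℂ)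
      = (t : ℂ) ^ ((u : ℂ) - 1) * (1 - (t : ℂ)) ^ ((v : ℂ) - 1) := by
  rw [uIcc_of_le zero_le_one] at ht
  have h : (0 : ℝ) ≤ 1 - t := sub_nonneg.2 ht.2
  rw [Complex.ofReal_mul, Complex.ofReal_cpow ht.1, Complex.ofReal_cpow h]
  push_cast
  rfl

lemma intervalIntegrable_rpow_mul_one_sub_rpow {u v : ℝ} (hu : 0 < u) (hv : 0 < v) :
    IntervalIntegrable (fun t : ℝ => t ^ (u - 1) * (1 - t) ^ (v - 1)) volume 0 1 := by
  have h := Complex.betaIntegral_convergent (u := u) (v := v) (by simpa) (by simpa)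
  have h' : IntervalIntegrable
      (fun t : ℝ => (((t ^ (u - 1) * (1 - t) ^ (v - 1) : ℝ)) : ℂ)) volume 0 1 :=
    h.congr fun t ht => (ofReal_rpow_mul_one_sub_rpow u v (uIoc_subset_uIcc ht)).symm
  rw [intervalIntegrable_iff] at h' ⊢
  exact h'.re

lemma integral_rpow_mul_one_sub_rpow {u v : ℝ} (hu : 0 < u) (hv : 0 < v) :
    ∫ t in (0 : ℝ)..1, t ^ (u - 1) * (1 - t) ^ (v - 1) = ProbabilityTheory.beta u v := by
  rw [ProbabilityTheory.beta_eq_betaIntegralReal u v hu hv, Complex.betaIntegral,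
    ← intervalIntegral.integral_congr fun t ht => ofReal_rpow_mul_one_sub_rpow u v ht,
    intervalIntegral.integral_ofReal, Complex.ofReal_re]

lemma abs_log_mul_rpow_le {x v : ℝ} (hx : 0 < x) (hx1 : x ≤ 1) (hv : 1 / 2 ≤ v) :
    |Real.log x * x ^ (v - 1)| ≤ 4 * x ^ ((1 / 4 : ℝ) - 1) := by
  have hsplit : x ^ (v - 1) = x ^ (v - 1 / 4) * x ^ ((1 / 4 : ℝ) - 1) := by
    rw [← Real.rpow_add hx]
    ring_nf
  have hpos := Real.rpow_pos_of_pos hx ((1 / 4 : ℝ) - 1)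
  have hlog := Real.abs_log_mul_self_rpow_lt x (v - 1 / 4) hx hx1 (by linarith)
  have hle : 1 / (v - 1 / 4) ≤ 4 := by
    rw [div_le_iff₀ (by linarith)]
    linarith
  rw [hsplit, ← mul_assoc, abs_mul, abs_of_pos hpos]
  exact mul_le_mul_of_nonneg_right (hlog.le.trans hle) hpos.le

lemma hasDerivAt_integral_rpow_mul_one_sub_rpow {u : ℝ} (hu : 0 < u) :
    HasDerivAt (fun v : ℝ => ∫ t in (0 : ℝ)..1, t ^ (u - 1) * (1 - t) ^ (v - 1))
      (∫ t in (0 : ℝ)..1, t ^ (u - 1) * Real.log (1 - t)) 1 := by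
  have h := (intervalIntegral.hasDerivAt_integral_of_dominated_loc_of_deriv_le
    (μ := volume) (a := 0) (b := 1) (x₀ := (1 : ℝ))
    (F := fun v t : ℝ => t ^ (u - 1) * (1 - t) ^ (v - 1))
    (F' := fun v t : ℝ => t ^ (u - 1) * (Real.log (1 - t) * (1 - t) ^ (v - 1)))
    (bound := fun t => 4 * (t ^ (u - 1) * (1 - t) ^ ((1 / 4 : ℝ) - 1)))
    (Ioi_mem_nhds (by norm_num : (1 / 2 : ℝ) < 1))
    (Eventually.of_forall fun v => by fun_prop)
    (intervalIntegrable_rpow_mul_one_sub_rpow hu one_pos)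
    (by fun_prop) ?_
    ((intervalIntegrable_rpow_mul_one_sub_rpow hu (by norm_num)).const_mul 4) ?_).2
  · simpa using h
  all_goals
    filter_upwards [compl_mem_ae_iff.2 (measure_singleton (1 : ℝ))] with t ht1 ht v hv
    rw [uIoc_of_le zero_le_one] at ht
    have hpos : 0 < 1 - t := sub_pos.2 (lt_of_le_of_ne ht.2 ht1)
  · have htu := Real.rpow_pos_of_pos ht.1 (u - 1)
    rw [norm_mul, Real.norm_of_nonneg htu.le, Real.norm_eq_abs, mul_left_comm]
    exact mul_le_mul_of_nonneg_left
      (abs_log_mul_rpow_le hpos (by linarith [ht.1]) (mem_Ioi.1 hv).le) htu.le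
  · simpa using (((hasDerivAt_id v).sub_const 1).const_rpow hpos).const_mul (t ^ (u - 1))

lemma beta_eq_add_div_mul_beta_add_one {u v : ℝ} (hu : 0 < u) (hv : 0 < v) :
    ProbabilityTheory.beta u v = (u + v) / v * ProbabilityTheory.beta u (v + 1) := by
  have huv : u + v ≠ 0 := (add_pos hu hv).ne'
  have hG := (Real.Gamma_pos_of_pos (add_pos hu hv)).ne'
  simp only [ProbabilityTheory.beta]
  rw [← add_assoc, Real.Gamma_add_one huv, Real.Gamma_add_one hv.ne']
  field_simp

lemma beta_one_right {u : ℝ} (hu : 0 < u) : ProbabilityTheory.beta u 1 = 1 / u := by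
  have hG := (Real.Gamma_pos_of_pos hu).ne'
  rw [ProbabilityTheory.beta, Real.Gamma_add_one hu.ne', Real.Gamma_one]
  field_simp


theorem beta_sub_inv_tendsto (u : ℝ) (hu : 0 < u) :
    deriv (fun v : ℝ => ∫ t in (0:ℝ)..1, t ^ (u - 1) * (1 - t) ^ (v - 1)) 1
      = ∫ t in (0:ℝ)..1, t ^ (u - 1) * Real.log (1 - t) ∧
    Filter.Tendsto
      (fun v : ℝ => (∫ t in (0:ℝ)..1, t ^ (u - 1) * (1 - t) ^ (v - 1)) - 1 / v)
      (nhdsWithin 0 (Set.Ioi 0))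
      (nhds (u * deriv (fun v : ℝ => ∫ t in (0:ℝ)..1, t ^ (u - 1) * (1 - t) ^ (v - 1)) 1
        + 1 / u)) := by
  have hderiv := hasDerivAt_integral_rpow_mul_one_sub_rpow hu
  refine ⟨hderiv.deriv, ?_⟩
  rw [hderiv.deriv]
  set B : ℝ → ℝ := fun v => ∫ t in (0 : ℝ)..1, t ^ (u - 1) * (1 - t) ^ (v - 1)
  have hBeta : ∀ v, 0 < v → B v = ProbabilityTheory.beta u v :=
    fun v hv => integral_rpow_mul_one_sub_rpow hu hv
  have hB1 : B 1 = 1 / u := (hBeta 1 one_pos).trans (beta_one_right hu)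
  have hslope := hderiv.tendsto_slope_zero_right
  have hcont : Tendsto (fun v => B (1 + v)) (𝓝[>] 0) (𝓝 (1 / u)) := by
    rw [← hB1]
    refine hderiv.continuousAt.tendsto.comp (tendsto_nhdsWithin_of_tendsto_nhds ?_)
    simpa using (continuous_const_add (1 : ℝ)).tendsto 0
  refine ((hslope.const_mul u).add hcont).congr' ?_
  filter_upwards [self_mem_nhdsWithin] with v hv
  have hv0 : 0 < v := hv
  change u * (v⁻¹ • (B (1 + v) - B 1)) + B (1 + v) = B v - 1 / v
  rw [hB1, hBeta v hv0, beta_eq_add_div_mul_beta_add_one hu hv0, add_comm v 1,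
    ← hBeta (1 + v) (by linarith), smul_eq_mul]
  field_simp
  ring
end

section
/- For real u with 0 < u, the limit as v → 0⁺ of (B(u,v) - 1/v) equals ∑_{n=1}^∞ (1-u)_n / (n · n!). -/
open Filter Topology MeasureTheory

/-- Generalized binomial series: `∑ (a)ₙ / n! tⁿ = (1 - t)⁻ᵃ` for `|t| < 1`. -/
lemma hasSum_ascPochhammer_div_factorial_mul_pow (a : ℝ) {t : ℝ} (ht : |t| < 1) :
    HasSum (fun n : ℕ => (ascPochhammer ℝ n).eval a / n.factorial * t ^ n)
      (1 / (1 - t) ^ a) := by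
  have h := (Real.one_div_one_sub_rpow_hasFPowerSeriesOnBall_zero a).hasSum (y := t) (by
    simpa [← ofReal_norm] using ht)
  rw [zero_add] at h
  refine h.congr_fun fun n => ?_
  have hc : Ring.choose (a + n - 1) n = (ascPochhammer ℝ n).eval a / n.factorial := by
    rw [← Ring.multichoose_eq, ← Polynomial.ascPochhammer_smeval_eq_eval,
      ← Ring.factorial_nsmul_multichoose_eq_ascPochhammer, nsmul_eq_mul]
    field_simp
  simp [hc, mul_comm]

lemma ascPochhammer_eval_succ_div_factorial (a : ℝ) (n : ℕ) :
    (ascPochhammer ℝ (n + 1)).eval a / (n + 1).factorial =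
      (ascPochhammer ℝ n).eval a / n.factorial * ((a + n) / (n + 1)) := by
  rw [ascPochhammer_succ_eval, Nat.factorial_succ]
  push_cast
  field_simp

lemma summable_abs_ascPochhammer_div_factorial_div {a : ℝ} (ha : a < 1) :
    Summable fun n : ℕ => |(ascPochhammer ℝ n).eval a / n.factorial| / ((n : ℝ) + 1) := by
  set c : ℕ → ℝ := fun n => (ascPochhammer ℝ n).eval a / n.factorial
  obtain ⟨N, hN⟩ := exists_nat_ge (-a)
  have hstep (n : ℕ) : |c (n + N)| / (((n + N : ℕ) : ℝ) + 1) =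
      |c (n + N)| / (1 - a) - |c (n + 1 + N)| / (1 - a) := by
    have h0 : 0 ≤ a + ((n + N : ℕ) : ℝ) := by push_cast; linarith [n.cast_nonneg (α := ℝ)]
    have h1 : |c (n + 1 + N)| = |c (n + N)| * ((a + (n + N : ℕ)) / ((n + N : ℕ) + 1)) := by
      rw [add_right_comm, show c (n + N + 1) = _ from ascPochhammer_eval_succ_div_factorial a _,
        abs_mul, abs_of_nonneg (a := (_ + _) / _) (by positivity)]
    have : 1 - a ≠ 0 := by linarith
    rw [h1]
    field_simp
    ring
  rw [← summable_nat_add_iff N]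
  refine summable_of_sum_range_le (c := |c N| / (1 - a)) (fun n => by positivity) fun n => ?_
  rw [Finset.sum_congr rfl fun i _ => hstep i,
    Finset.sum_range_sub' fun i => |c (i + N)| / (1 - a), zero_add]
  have : 0 < 1 - a := by linarith
  exact sub_le_self _ (by positivity)

lemma summable_abs_ascPochhammer_succ_div_factorial_div {a : ℝ} (ha : a < 1) :
    Summable fun n : ℕ =>
      |(ascPochhammer ℝ (n + 1)).eval a / (n + 1).factorial| / ((n : ℝ) + 1) := by
  have h := (summable_nat_add_iff 1).2 (summable_abs_ascPochhammer_div_factorial_div ha)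
  refine (h.mul_left 2).of_nonneg_of_le (fun n => by positivity) fun n => ?_
  have hn : (0 : ℝ) ≤ n := n.cast_nonneg
  rw [← mul_div_assoc, div_le_div_iff₀ (by positivity) (by positivity)]
  push_cast
  nlinarith [mul_nonneg (abs_nonneg
    ((ascPochhammer ℝ (n + 1)).eval a / (n + 1).factorial)) hn]

lemma norm_ascPochhammer_succ_div_add_le (a : ℝ) {v : ℝ} (hv : 0 ≤ v) (n : ℕ) :
    ‖(ascPochhammer ℝ (n + 1)).eval a / (n + 1).factorial / (((n + 1 : ℕ) : ℝ) + v)‖ ≤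
      |(ascPochhammer ℝ (n + 1)).eval a / (n + 1).factorial| / ((n : ℝ) + 1) := by
  rw [norm_div, Real.norm_eq_abs, Real.norm_of_nonneg (by positivity)]
  push_cast
  exact div_le_div_of_nonneg_left (abs_nonneg _) (by positivity) (le_add_of_nonneg_right hv)

lemma summable_ascPochhammer_div_factorial_div_add {a v : ℝ} (ha : a < 1) (hv : 0 ≤ v) :
    Summable fun n : ℕ => (ascPochhammer ℝ n).eval a / n.factorial / ((n : ℝ) + v) :=
  (summable_nat_add_iff 1).1 <|
    (summable_abs_ascPochhammer_succ_div_factorial_div ha).of_norm_bounded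
      (norm_ascPochhammer_succ_div_add_le a hv)

/-- Series expansion of the Beta integral. -/
lemma hasSum_beta_integral {u v : ℝ} (hu : 0 < u) (hv : 0 < v) :
    HasSum (fun n : ℕ => (ascPochhammer ℝ n).eval (1 - u) / n.factorial / ((n : ℝ) + v))
      (∫ t in (0 : ℝ)..1, t ^ (v - 1) * (1 - t) ^ (u - 1)) := by
  set c : ℕ → ℝ := fun n => (ascPochhammer ℝ n).eval (1 - u) / n.factorial
  have hexp (n : ℕ) : -1 < (n : ℝ) + v - 1 := by linarith [n.cast_nonneg (α := ℝ)]
  have hmono (b : ℝ) (n : ℕ) :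
      ∫ t in Set.Ioc (0 : ℝ) 1, b * t ^ ((n : ℝ) + v - 1) = b / (n + v) := by
    have := hexp n
    rw [← intervalIntegral.integral_of_le zero_le_one, intervalIntegral.integral_const_mul,
      integral_rpow (.inl this), Real.one_rpow, Real.zero_rpow (by linarith)]
    simp [div_eq_mul_inv]
  have hint (n : ℕ) : Integrable (fun t : ℝ => c n * t ^ ((n : ℝ) + v - 1))
      (volume.restrict (Set.Ioc 0 1)) :=
    ((intervalIntegrable_iff_integrableOn_Ioc_of_le zero_le_one).1
      (intervalIntegral.intervalIntegrable_rpow' (hexp n))).const_mul _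
  have hnorm (n : ℕ) : ∫ t in Set.Ioc (0 : ℝ) 1, ‖c n * t ^ ((n : ℝ) + v - 1)‖ =
      ‖c n / (n + v)‖ := by
    rw [norm_div, Real.norm_of_nonneg (r := (n : ℝ) + v) (by positivity), ← hmono]
    refine setIntegral_congr_fun measurableSet_Ioc fun t ht => ?_
    simp only [norm_mul]
    rw [Real.norm_of_nonneg (Real.rpow_nonneg ht.1.le _)]
  have hsum := hasSum_integral_of_summable_integral_norm hint (by
    simp_rw [hnorm]
    exact (summable_ascPochhammer_div_factorial_div_add (by linarith) hv.le).norm)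
  simp_rw [hmono] at hsum
  convert! hsum using 1
  rw [intervalIntegral.integral_of_le zero_le_one, integral_Ioc_eq_integral_Ioo,
    integral_Ioc_eq_integral_Ioo]
  refine setIntegral_congr_fun measurableSet_Ioo fun t ht => ?_
  have hser := (hasSum_ascPochhammer_div_factorial_mul_pow (1 - u)
    (abs_lt.2 ⟨by linarith [ht.1], ht.2⟩)).mul_left (t ^ (v - 1))
  have hpow : 1 / (1 - t) ^ (1 - u) = (1 - t) ^ (u - 1) := by
    rw [one_div, ← Real.rpow_neg (by linarith [ht.2]), neg_sub]
  rw [hpow] at hser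
  rw [← hser.tsum_eq]
  refine tsum_congr fun n => ?_
  rw [add_sub_assoc, Real.rpow_add ht.1, Real.rpow_natCast]
  ring

theorem beta_sub_inv_limit_series (u : ℝ) (hu : 0 < u) :
    Filter.Tendsto
      (fun v : ℝ => (∫ t in (0:ℝ)..1, t ^ (v - 1) * (1 - t) ^ (u - 1)) - 1 / v)
      (nhdsWithin 0 (Set.Ioi 0))
      (nhds (∑' n : ℕ,
        (ascPochhammer ℝ (n + 1)).eval (1 - u) / (((n : ℝ) + 1) * (Nat.factorial (n + 1) : ℝ)))) := by
  have ha : 1 - u < 1 := by linarith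
  have hlim := tendsto_tsum_of_dominated_convergence (𝓕 := 𝓝[>] (0 : ℝ))
    (f := fun v n => (ascPochhammer ℝ (n + 1)).eval (1 - u) / (n + 1).factorial /
      (((n + 1 : ℕ) : ℝ) + v))
    (g := fun n => (ascPochhammer ℝ (n + 1)).eval (1 - u) /
      (((n : ℝ) + 1) * (Nat.factorial (n + 1) : ℝ)))
    (summable_abs_ascPochhammer_succ_div_factorial_div ha) (fun n => by
      have : ContinuousAt (fun v : ℝ => (ascPochhammer ℝ (n + 1)).eval (1 - u) /
          (n + 1).factorial / (((n + 1 : ℕ) : ℝ) + v)) 0 := by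
        refine continuousAt_const.div (by fun_prop) ?_
        push_cast
        positivity
      convert! this.tendsto.mono_left nhdsWithin_le_nhds using 2
      push_cast
      rw [add_zero, div_div, mul_comm])
    (eventually_mem_nhdsWithin.mono fun v (hv : 0 < v) n =>
      norm_ascPochhammer_succ_div_add_le (1 - u) hv.le n)
  refine hlim.congr' (eventually_mem_nhdsWithin.mono fun v (hv : 0 < v) => ?_)
  have h := hasSum_beta_integral hu hv
  beta_reduce
  rw [← h.tsum_eq, h.summable.tsum_eq_zero_add]
  simp
end
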